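/- Let f : [0,1]^J → ℝ be continuous and strictly positive, let m : [0,1]^J → ℝ be continuous, let 𝔏 be a finite family of distinct nonempty subsets of 𝐉 = {1,…,J} with nonzero real coefficients (c_l), let l̂ ∈ 𝔏 be a leading term of 𝔏, and define G(q) = ∑_{l∈𝔏} c_l ∫_{A_l(q)} m(v) f(v) dv. Then for every q ∈ (0,1)^J, the mixed partial derivative of G taken once with respect to each coordinate q_j with j ∈ l̂ exists and equals c_{l̂} ∫_{[0,1]^{𝐉∖l̂}} m(ρ(q,w)) f(ρ(q,w)) dw, where ρ(q,w)_j = q_j for j ∈ l̂ and ρ(q,w)_j = w_j for j ∉ l̂. Equivalently, writing f_{l̂}((q_j)_{j∈l̂}) = ∫_{[0,1]^{𝐉∖l̂}} f(ρ(q,w)) dw for the marginal density and m̄((q_j)_{j∈l̂}) = (∫_{[0,1]^{𝐉∖l̂}} m(ρ(q,w)) f(ρ(q,w)) dw) / f_{l̂}((q_j)_{j∈l̂}) for the conditional mean of m given the coordinates in l̂, the mixed partial equals c_{l̂} · m̄((q_j)_{j∈l̂}) · f_{l̂}((q_j)_{j∈l̂}). -/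

import Mathlib

open MeasureTheory

/-- `HasPartialDerivAt G j q v`: the partial derivative of `G : ℝ^J → ℝ` with respect to
the `j`-th coordinate exists at the point `q` and equals `v`. -/
def HasPartialDerivAt {J : ℕ} (G : (Fin J → ℝ) → ℝ) (j : Fin J)
    (q : Fin J → ℝ) (v : ℝ) : Prop :=
  HasDerivAt (fun t : ℝ => G (Function.update q j t)) v (q j)

/-- `HasMixedPartialOn S G L h`: on the set `S`, the iterated partial derivatives of `G`
taken successively once with respect to each coordinate in the list `L` exist, and the
resulting function coincides with `h` on `S`. -/
def HasMixedPartialOn {J : ℕ} (S : Set (Fin J → ℝ)) :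
    ((Fin J → ℝ) → ℝ) → List (Fin J) → ((Fin J → ℝ) → ℝ) → Prop
  | G, [], h => ∀ q ∈ S, G q = h q
  | G, j :: L, h => ∃ G' : (Fin J → ℝ) → ℝ,
      (∀ q ∈ S, HasPartialDerivAt G j q (G' q)) ∧ HasMixedPartialOn S G' L h

/-- `α_l(q)`: the corner with `α_l(q)_j = q_j` for `j ∈ l` and `= 1` for `j ∉ l`. -/
def alphaCorner {J : ℕ} (l : Finset (Fin J)) (q : Fin J → ℝ) : Fin J → ℝ :=
  fun j => if j ∈ l then q j else 1

/-- `ρ(q,w)`: the point with coordinates `q_j` for `j ∈ l` and `w_j` for `j ∉ l`. -/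
def rho {J : ℕ} (l : Finset (Fin J)) (q w : Fin J → ℝ) : Fin J → ℝ :=
  fun j => if j ∈ l then q j else w j

open Set Filter Topology

/-- Functions that agree on an open set have the same mixed partials there. -/
theorem HasMixedPartialOn.congr {J : ℕ} {S : Set (Fin J → ℝ)} (hS : IsOpen S)
    {G G' : (Fin J → ℝ) → ℝ} {L : List (Fin J)} {h : (Fin J → ℝ) → ℝ}
    (hG : HasMixedPartialOn S G L h) (hGG' : ∀ q ∈ S, G' q = G q) :
    HasMixedPartialOn S G' L h := by
  cases L with
  | nil => exact fun q hq => (hGG' q hq).trans (hG q hq)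
  | cons j L =>
    obtain ⟨D, hD, hL⟩ := hG
    refine ⟨D, fun q hq => ?_, hL⟩
    have hcont : ContinuousAt (fun t : ℝ => Function.update q j t) (q j) := by fun_prop
    have hmem : ∀ᶠ t in 𝓝 (q j), Function.update q j t ∈ S :=
      hcont.eventually_mem (hS.mem_nhds (by simpa using hq))
    exact (hD q hq).congr_of_eventuallyEq (hmem.mono fun t ht => hGG' _ ht)

theorem HasMixedPartialOn.congr_right {J : ℕ} {S : Set (Fin J → ℝ)} {L : List (Fin J)}
    {G h h' : (Fin J → ℝ) → ℝ} (hG : HasMixedPartialOn S G L h) (hhh' : ∀ q ∈ S, h q = h' q) :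
    HasMixedPartialOn S G L h' := by
  induction L generalizing G with
  | nil => exact fun q hq => (hG q hq).trans (hhh' q hq)
  | cons j L ih =>
    obtain ⟨D, hD, hL⟩ := hG
    exact ⟨D, hD, ih hL⟩

/-- Fubini for boxes in `ℝ^(n+1)`, integrating out the `j`-th coordinate last. -/
theorem setIntegral_Icc_succAbove {n : ℕ} (j : Fin (n + 1)) (a b : Fin (n + 1) → ℝ)
    {Φ : (Fin (n + 1) → ℝ) → ℝ} (hΦ : Continuous Φ) :
    ∫ w in Icc a b, Φ w = ∫ t in Icc (a j) (b j),
      ∫ w in Icc (j.removeNth a) (j.removeNth b), Φ (j.insertNth t w) := by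
  let e := MeasurableEquiv.piFinSuccAbove (fun _ : Fin (n + 1) => ℝ) j
  have he : MeasurePreserving e.symm volume volume :=
    (volume_preserving_piFinSuccAbove (fun _ : Fin (n + 1) => ℝ) j).symm
  have hpre : e.symm ⁻¹' Icc a b =
      Icc (a j) (b j) ×ˢ Icc (j.removeNth a) (j.removeNth b) := by
    ext ⟨t, w⟩
    change j.insertNth t w ∈ Icc a b ↔ _
    simp only [Fin.insertNth_mem_Icc, mem_prod]
    rfl
  have hcont : Continuous fun p : ℝ × (Fin n → ℝ) => Φ (j.insertNth p.1 p.2) :=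
    hΦ.comp (Continuous.finInsertNth (A := fun _ => ℝ) j continuous_fst continuous_snd)
  rw [← he.setIntegral_preimage_emb e.symm.measurableEmbedding, hpre]
  exact setIntegral_prod (fun p : ℝ × (Fin n → ℝ) => Φ (j.insertNth p.1 p.2))
    (hcont.continuousOn.integrableOn_compact (isCompact_Icc.prod isCompact_Icc))

theorem continuous_rho {J : ℕ} (s : Finset (Fin J)) (q : Fin J → ℝ) : Continuous (rho s q) := by
  refine continuous_pi fun i => ?_
  by_cases hi : i ∈ s <;> simp only [rho, hi, if_true, if_false] <;> fun_prop

theorem rho_update_of_notMem {J : ℕ} {s : Finset (Fin J)} {j : Fin J} (hj : j ∉ s)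
    (q : Fin J → ℝ) (t : ℝ) : rho s (Function.update q j t) = rho s q := by
  ext w i
  by_cases hi : i ∈ s
  · simp [rho, hi, ne_of_mem_of_not_mem hi hj]
  · simp [rho, hi]

theorem alphaCorner_update_of_notMem {J : ℕ} {l : Finset (Fin J)} {j : Fin J} (hj : j ∉ l)
    (q : Fin J → ℝ) (t : ℝ) : alphaCorner l (Function.update q j t) = alphaCorner l q := by
  ext i
  by_cases hi : i ∈ l
  · simp [alphaCorner, hi, ne_of_mem_of_not_mem hi hj]
  · simp [alphaCorner, hi]

/-- The integral of `H` over the box `A_l(q)`, with the coordinates in `s` frozen at `q`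
instead of being integrated. -/
noncomputable def frozenBoxIntegral {J : ℕ} (H : (Fin J → ℝ) → ℝ) (l s : Finset (Fin J))
    (q : Fin J → ℝ) : ℝ :=
  ∫ w in Icc (0 : Fin J → ℝ) (alphaCorner (l \ s) q), H (rho s q w)

theorem hasPartialDerivAt_frozenBoxIntegral {J : ℕ} {H : (Fin J → ℝ) → ℝ} (hH : Continuous H)
    {l s : Finset (Fin J)} {j : Fin J} (hjl : j ∈ l) (hjs : j ∉ s)
    {q : Fin J → ℝ} (hq : 0 < q j) :
    HasPartialDerivAt (frozenBoxIntegral H l s) j q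
      (frozenBoxIntegral H l (insert j s) q) := by
  obtain _ | n := J
  · exact j.elim0
  let b : Fin n → ℝ := j.removeNth (alphaCorner (l \ s) q)
  let g : ℝ → ℝ := fun x => ∫ w in Icc (0 : Fin n → ℝ) b, H (rho s q (j.insertNth x w))
  have hg : Continuous g := by
    refine continuous_parametric_integral_of_continuous
      (f := fun x w => H (rho s q (j.insertNth x w))) ?_ isCompact_Icc
    exact (hH.comp (continuous_rho s q)).comp
      (Continuous.finInsertNth (A := fun _ => ℝ) j continuous_fst continuous_snd)
  have hfrozen : frozenBoxIntegral H l (insert j s) q = g (q j) := by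
    have hb : j.removeNth (alphaCorner (l \ insert j s) q) = b := by
      ext i
      simp [b, Fin.removeNth, alphaCorner]
    have hrho : ∀ t w, rho (insert j s) q (j.insertNth t w) = rho s q (j.insertNth (q j) w) := by
      intro t w
      ext i
      rcases Fin.eq_self_or_eq_succAbove j i with rfl | ⟨k, rfl⟩ <;> simp [rho]
    rw [frozenBoxIntegral, setIntegral_Icc_succAbove (Φ := fun w => H (rho (insert j s) q w)) j _ _
      (hH.comp (continuous_rho _ q)), hb]
    simp only [hrho]
    simp [alphaCorner, g]
    rfl
  have hslice : ∀ t, 0 ≤ t →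
      frozenBoxIntegral H l s (Function.update q j t) = ∫ x in (0 : ℝ)..t, g x := by
    intro t ht
    have hb : j.removeNth (alphaCorner (l \ s) (Function.update q j t)) = b := by
      ext i
      simp [b, Fin.removeNth, alphaCorner]
    rw [frozenBoxIntegral, rho_update_of_notMem hjs,
      setIntegral_Icc_succAbove (Φ := fun w => H (rho s q w)) j _ _
        (hH.comp (continuous_rho s q)), hb,
      intervalIntegral.integral_of_le ht, ← integral_Icc_eq_integral_Ioc]
    simp [alphaCorner, hjl, hjs, g]
    rfl
  rw [hfrozen]
  refine (hg.integral_hasStrictDerivAt 0 (q j)).hasDerivAt.congr_of_eventuallyEq ?_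
  filter_upwards [lt_mem_nhds hq] with t ht using hslice t ht.le

/-- Freezing one more coordinate differentiates a box integral; the box integral over `A_l`
contributes only while the frozen coordinates lie in `l`. -/
theorem hasPartialDerivAt_ite_frozenBoxIntegral {J : ℕ} {H : (Fin J → ℝ) → ℝ}
    (hH : Continuous H) (l : Finset (Fin J)) {s : Finset (Fin J)} {j : Fin J} (hjs : j ∉ s)
    {q : Fin J → ℝ} (hq : 0 < q j) :
    HasPartialDerivAt (fun q => if s ⊆ l then frozenBoxIntegral H l s q else 0) j q
      (if insert j s ⊆ l then frozenBoxIntegral H l (insert j s) q else 0) := by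
  by_cases hsl : s ⊆ l
  · by_cases hjl : j ∈ l
    · simpa [hsl, hjl, Finset.insert_subset_iff] using
        hasPartialDerivAt_frozenBoxIntegral hH hjl hjs hq
    · have hj : j ∉ l \ s := fun h => hjl (Finset.mem_sdiff.1 h).1
      simpa [hsl, hjl, Finset.insert_subset_iff, HasPartialDerivAt, frozenBoxIntegral,
        rho_update_of_notMem hjs, alphaCorner_update_of_notMem hj] using
        hasDerivAt_const (q j) (frozenBoxIntegral H l s q)
  · simpa [hsl, Finset.insert_subset_iff, HasPartialDerivAt] using hasDerivAt_const (q j) (0 : ℝ)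

theorem hasMixedPartialOn_sum_frozenBoxIntegral {J : ℕ} {H : (Fin J → ℝ) → ℝ}
    (hH : Continuous H) {S : Set (Fin J → ℝ)} (hS : ∀ q ∈ S, ∀ j, 0 < q j)
    (𝔏 : Finset (Finset (Fin J))) (c : Finset (Fin J) → ℝ) (L : List (Fin J))
    (s : Finset (Fin J)) (hL : L.Nodup) (hs : ∀ j ∈ L, j ∉ s) :
    HasMixedPartialOn S
      (fun q => ∑ l ∈ 𝔏, c l * if s ⊆ l then frozenBoxIntegral H l s q else 0) L
      (fun q => ∑ l ∈ 𝔏, c l *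
        if s ∪ L.toFinset ⊆ l then frozenBoxIntegral H l (s ∪ L.toFinset) q else 0) := by
  induction L generalizing s with
  | nil => simp [HasMixedPartialOn]
  | cons j L ih =>
    obtain ⟨hjL, hL⟩ := List.nodup_cons.1 hL
    have hunion : s ∪ (j :: L).toFinset = insert j s ∪ L.toFinset := by
      simp [Finset.union_insert, Finset.insert_union]
    rw [hunion]
    refine ⟨_, fun q hq => ?_, ih (insert j s) hL fun i hi => ?_⟩
    · exact HasDerivAt.fun_sum fun l _ =>
        (hasPartialDerivAt_ite_frozenBoxIntegral hH l (hs j (by simp)) (hS q hq j)).const_mul (c l)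
    · simp [hs i (by simp [hi]), ne_of_mem_of_not_mem hi hjL]

theorem exists_continuous_eqOn_Icc {J : ℕ} {k : (Fin J → ℝ) → ℝ}
    (hk : ContinuousOn k (Icc 0 1)) : ∃ H, Continuous H ∧ EqOn H k (Icc 0 1) := by
  refine ⟨fun v => k ((v ⊔ 0) ⊓ 1), hk.comp_continuous ?_ fun v => ?_, fun v hv => ?_⟩
  · exact continuous_pi fun i =>
      ((continuous_apply i).max continuous_const).min continuous_const
  · exact ⟨le_inf le_sup_right zero_le_one, inf_le_right⟩
  · change k ((v ⊔ 0) ⊓ 1) = k v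
    rw [sup_eq_left.2 hv.1, inf_eq_left.2 hv.2]

/-- with `f > 0` continuous, `m` continuous,
`G(q) = ∑_{l∈𝔏} c_l ∫_{A_l(q)} m(v) f(v) dv`, and `lhat ∈ 𝔏` a leading term of `𝔏`,
the mixed partial derivative of `G` taken once with respect to each coordinate `q_j`
with `j ∈ lhat` exists on `(0,1)^J` and equals
`c_{lhat} ∫_{[0,1]^{𝐉∖lhat}} m(ρ(q,w)) f(ρ(q,w)) dw`
`= c_{lhat} · m̄((q_j)_{j∈lhat}) · f_{lhat}((q_j)_{j∈lhat})`, i.e. `c_{lhat}` times the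
conditional mean of `m` given the coordinates in `lhat` times the marginal density.
(Integrating `ρ(q,·)` over the full cube `[0,1]^J` integrates out exactly the
coordinates outside `lhat`.) -/
theorem conditional_mtr_identified_from_leading_term (J : ℕ) (hJ : 1 ≤ J)
    (f : (Fin J → ℝ) → ℝ) (hf : ContinuousOn f (Set.Icc 0 1)) (hfpos : ∀ v, 0 < f v)
    (m : (Fin J → ℝ) → ℝ) (hm : ContinuousOn m (Set.Icc 0 1))
    (𝔏 : Finset (Finset (Fin J))) (h𝔏 : ∀ l ∈ 𝔏, l.Nonempty)
    (c : Finset (Fin J) → ℝ) (hc : ∀ l ∈ 𝔏, c l ≠ 0)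
    (lhat : Finset (Fin J)) (hlhat : lhat ∈ 𝔏)
    (hlead : ∀ l' ∈ 𝔏, l' ≠ lhat → ¬ lhat ⊆ l')
    (G : (Fin J → ℝ) → ℝ)
    (hG : ∀ q : Fin J → ℝ,
      G q = ∑ l ∈ 𝔏, c l * ∫ v in Set.Icc (0 : Fin J → ℝ) (alphaCorner l q), m v * f v) :
    HasMixedPartialOn (Set.univ.pi fun _ : Fin J => Set.Ioo (0 : ℝ) 1)
      G (lhat.sort (· ≤ ·))
      (fun q => c lhat *
        ∫ w in Set.Icc (0 : Fin J → ℝ) 1, m (rho lhat q w) * f (rho lhat q w)) := by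
  obtain ⟨H, hH, hHeq⟩ := exists_continuous_eqOn_Icc (hm.mul hf)
  have hopen : IsOpen (univ.pi fun _ : Fin J => Ioo (0 : ℝ) 1) :=
    isOpen_set_pi finite_univ fun _ _ => isOpen_Ioo
  have hmixed := hasMixedPartialOn_sum_frozenBoxIntegral hH
    (S := univ.pi fun _ : Fin J => Ioo (0 : ℝ) 1) (fun q hq j => (hq j trivial).1) 𝔏 c
    (lhat.sort (· ≤ ·)) ∅ (Finset.sort_nodup _ _) (by simp)
  simp only [Finset.empty_union, Finset.sort_toFinset] at hmixed
  have hend : ∀ q ∈ univ.pi fun _ : Fin J => Ioo (0 : ℝ) 1,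
      (∑ l ∈ 𝔏, c l * if lhat ⊆ l then frozenBoxIntegral H l lhat q else 0) =
        c lhat * ∫ w in Icc (0 : Fin J → ℝ) 1, m (rho lhat q w) * f (rho lhat q w) := by
    intro q hq
    rw [Finset.sum_eq_single_of_mem lhat hlhat fun l hl hne => by simp [hlead l hl hne]]
    have hcorner : alphaCorner (∅ : Finset (Fin J)) q = 1 := by
      ext i
      simp [alphaCorner]
    rw [if_pos (Finset.Subset.refl lhat), frozenBoxIntegral, Finset.sdiff_self, hcorner]
    congr 1
    refine setIntegral_congr_fun measurableSet_Icc fun w hw => hHeq ⟨fun i => ?_, fun i => ?_⟩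
    · by_cases hi : i ∈ lhat
      · simpa [rho, hi] using (hq i trivial).1.le
      · simpa [rho, hi] using hw.1 i
    · by_cases hi : i ∈ lhat
      · simpa [rho, hi] using (hq i trivial).2.le
      · simpa [rho, hi] using hw.2 i
  refine HasMixedPartialOn.congr hopen (hmixed.congr_right hend) fun q hq => ?_
  rw [hG]
  refine Finset.sum_congr rfl fun l _ => ?_
  have hrho : rho (∅ : Finset (Fin J)) q = id := by
    ext w i
    simp [rho]
  simp only [Finset.empty_subset, if_true, frozenBoxIntegral, Finset.sdiff_empty, hrho, id]
  congr 1
  refine setIntegral_congr_fun measurableSet_Icc fun v hv => (hHeq ⟨hv.1, fun i => ?_⟩).symm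
  refine (hv.2 i).trans ?_
  by_cases hi : i ∈ l
  · simpa [alphaCorner, hi] using (hq i trivial).2.le
  · simp [alphaCorner, hi]
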